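/- Let p be a probability distribution on ℤ with finite entropy H(p) = c. Then H(p⋆p) − c ≥ g(c), where g(c) = min_{x∈[0,1]} max( c·x − h₂(x) , (1−x)²·((1−x) ∨ (4x−2)⁺)² / (8 ln 2) ). -/

import Mathlib

/-- Binary entropy function (in bits), with the convention `0 * log₂ 0 = 0`. -/
noncomputable def H2 (x : ℝ) : ℝ := -(x * Real.logb 2 x) - (1 - x) * Real.logb 2 (1 - x)

/-- `p` is a probability distribution on `ℤ`. -/
def IsPMF (p : ℤ → ℝ) : Prop := (∀ k, 0 ≤ p k) ∧ HasSum p 1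

/-- Convolution of two distributions on `ℤ`. -/
noncomputable def conv (p q : ℤ → ℝ) : ℤ → ℝ := fun k => ∑' j, p j * q (k - j)

/-- Shannon entropy (in bits) of a distribution on `ℤ`. -/
noncomputable def entH (p : ℤ → ℝ) : ℝ := ∑' k, -(p k * Real.logb 2 (p k))

/-- The function `g(c) = min_{x ∈ [0,1]} max( c·x − h₂(x) ,
(1−x)²·((1−x) ∨ (4x−2)⁺)² / (8 ln 2) )`. -/
noncomputable def gIID (c : ℝ) : ℝ :=
  sInf ((fun x : ℝ => max (c * x - H2 x)
    ((1 - x) ^ 2 * (max (1 - x) (max (4 * x - 2) 0)) ^ 2 / (8 * Real.log 2)))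
    '' Set.Icc (0 : ℝ) 1)

open Real in
theorem aux_deriv (t : ℝ) (ht : 0 < t) :
    HasDerivAt (fun t => 2 * (t + 2) * (t * log t - t + 1) - 3 * (t - 1) ^ 2)
      (4 * (t + 1) * log t - 8 * (t - 1)) t := by
  have h1 := Real.hasDerivAt_log ht.ne'
  have hid := hasDerivAt_id t
  have h2 := (((hid.add_const 2).const_mul 2).mul (((hid.mul h1).sub hid).add_const 1)).sub
    (((hid.sub_const 1).pow 2).const_mul 3)
  have e : (4 * (t + 1) * log t - 8 * (t - 1)) =
      2 * 1 * ((t * log t - t) + 1) + 2 * (t + 2) * (1 * log t + t * t⁻¹ - 1) -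
      3 * (((2 : ℕ) : ℝ) * (t - 1) ^ (2 - 1) * 1) := by
    rw [mul_inv_cancel₀ ht.ne']
    push_cast
    ring
  rw [e]
  exact h2

open Real in
theorem aux_log_ge (t : ℝ) (ht : 1 ≤ t) : 8 * (t - 1) ≤ 4 * (t + 1) * log t := by
  have h := Real.le_log_one_add_of_nonneg (x := t - 1) (by linarith)
  rw [div_le_iff₀ (by linarith), show 1 + (t - 1) = t by ring] at h
  nlinarith

open Real in
theorem aux_log_le (t : ℝ) (h0 : 0 < t) (ht : t ≤ 1) : 4 * (t + 1) * log t ≤ 8 * (t - 1) := by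
  have h := aux_log_ge t⁻¹ ((one_le_inv₀ h0).2 ht)
  rw [Real.log_inv] at h
  have h2 := mul_le_mul_of_nonneg_left h h0.le
  have e : t * t⁻¹ = 1 := mul_inv_cancel₀ h0.ne'
  have e1 : t * (8 * (t⁻¹ - 1)) = 8 * (1 - t) := by linear_combination 8 * e
  have e2 : t * (4 * (t⁻¹ + 1) * -log t) = - (4 * (t + 1) * log t) := by
    linear_combination (-4 * log t) * e
  linarith

open Real in
theorem aux_one (t : ℝ) (ht : 0 < t) :
    3 * (t - 1) ^ 2 ≤ 2 * (t + 2) * (t * log t - t + 1) := by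
  set f : ℝ → ℝ := fun t => 2 * (t + 2) * (t * log t - t + 1) - 3 * (t - 1) ^ 2 with hf
  have f1 : f 1 = 0 := by simp [hf]
  have hd : ∀ t, 0 < t → HasDerivAt f (4 * (t + 1) * log t - 8 * (t - 1)) t := aux_deriv
  suffices 0 ≤ f t by simp only [hf] at this; linarith
  rcases le_total 1 t with h | h
  · have hm : MonotoneOn f (Set.Ici 1) := by
      apply monotoneOn_of_deriv_nonneg (convex_Ici 1)
      · intro x hx
        exact (hd x (by linarith [Set.mem_Ici.1 hx])).continuousAt.continuousWithinAt
      · intro x hx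
        rw [interior_Ici] at hx
        exact (hd x (by linarith [Set.mem_Ioi.1 hx])).differentiableAt.differentiableWithinAt
      · intro x hx
        rw [interior_Ici] at hx
        have := Set.mem_Ioi.1 hx
        rw [(hd x (by linarith)).deriv]
        linarith [aux_log_ge x this.le]
    rw [← f1]
    exact hm (Set.mem_Ici.2 le_rfl) h h
  · have hm : AntitoneOn f (Set.Ioc 0 1) := by
      apply antitoneOn_of_deriv_nonpos (convex_Ioc 0 1)
      · intro x hx
        exact (hd x hx.1).continuousAt.continuousWithinAt
      · intro x hx
        rw [interior_Ioc] at hx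
        exact (hd x hx.1).differentiableAt.differentiableWithinAt
      · intro x hx
        rw [interior_Ioc] at hx
        rw [(hd x hx.1).deriv]
        linarith [aux_log_le x hx.1 hx.2.le]
    rw [← f1]
    exact hm ⟨ht, h⟩ ⟨one_pos, le_rfl⟩ h

open Real in
/-- pointwise Pinsker inequality -/
theorem pinsker_pt (a r N : ℝ) (ha : 0 ≤ a) (hr : 0 ≤ r) (h0 : r = 0 → a = 0) :
    negMulLog a + (N * |a - r| - N ^ 2 / 6 * (a + 2 * r)) + a - r ≤ -(a * log r) := by
  rcases hr.eq_or_lt with h | hr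
  · have := h0 h.symm
    subst this; subst h; simp
  have key : 2 * (a + 2 * r) * (a * log a - a * log r - a + r) ≥ 3 * (a - r) ^ 2 := by
    rcases ha.eq_or_lt with h | ha
    · subst h; simp; nlinarith
    have h := aux_one (a / r) (by positivity)
    rw [Real.log_div ha.ne' hr.ne'] at h
    have h2 := mul_le_mul_of_nonneg_left h (sq_nonneg r)
    have e1 : r ^ 2 * (3 * (a / r - 1) ^ 2) = 3 * (a - r) ^ 2 := by field_simp
    have e2 : r ^ 2 * (2 * (a / r + 2) * (a / r * (log a - log r) - a / r + 1)) =
      2 * (a + 2 * r) * (a * log a - a * log r - a + r) := by field_simp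
    linarith
  have hw : 0 < a + 2 * r := by linarith
  have h3 : N * |a - r| - N ^ 2 / 6 * (a + 2 * r) ≤ a * log a - a * log r - a + r := by
    by_contra hcon
    push Not at hcon
    have := mul_lt_mul_of_pos_left hcon (show 0 < 2 * (a + 2 * r) by linarith)
    have h4 : |a - r| ^ 2 = (a - r) ^ 2 := sq_abs _
    nlinarith [sq_nonneg (3 * |a - r| - N * (a + 2 * r))]
  unfold negMulLog
  linarith

open Real in
theorem hasSum_abs_le {f g : ℤ → ℝ} (hf : Summable f) (h : ∀ k, |g k| ≤ f k) : Summable g :=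
  Summable.of_norm_bounded hf (by simpa using h)

theorem IsPMF.le_one {p : ℤ → ℝ} (hp : IsPMF p) (k : ℤ) : p k ≤ 1 := by
  have := hp.2.summable.le_tsum k (fun j _ => hp.1 j)
  rwa [hp.2.tsum_eq] at this

theorem IsPMF.nml {p : ℤ → ℝ} (hp : IsPMF p) (k : ℤ) : 0 ≤ Real.negMulLog (p k) :=
  Real.negMulLog_nonneg (hp.1 k) (hp.le_one k)

/-- entropy in nats -/
noncomputable def En (p : ℤ → ℝ) : ℝ := ∑' k, Real.negMulLog (p k)

/-- summable entropy -/
def FE (p : ℤ → ℝ) : Prop := Summable fun k => Real.negMulLog (p k)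

open Real in
theorem mix (a b : ℤ → ℝ) (ha : IsPMF a) (hb : IsPMF b) (ea : FE a) (eb : FE b) (α β M : ℝ)
    (hα : 0 ≤ α) (hβ : 0 ≤ β) (hαβ : α + β = 1) (r : ℤ → ℝ) (hr : ∀ k, r k = α * a k + β * b k)
    (er : FE r) (hM : 0 ≤ M) (hM' : M ≤ ∑' k, |a k - b k|) :
    α * En a + β * En b + α * β * M ^ 2 / 2 ≤ En r := by
  have hab : Summable fun k => |a k - b k| := (ha.2.summable.sub hb.2.summable).abs
  have pt : ∀ k, α * negMulLog (a k) + β * negMulLog (b k) + (α * β * M * |a k - b k|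
      - α * β * M ^ 2 / 6 * (β * (a k + 2 * r k) + α * (b k + 2 * r k)))
      ≤ negMulLog (r k) := by
    intro k
    have hak := ha.1 k
    have hbk := hb.1 k
    have hrk : 0 ≤ r k := by rw [hr]; positivity
    have t1 : α * (negMulLog (a k) + (β * M * |a k - r k| - (β * M) ^ 2 / 6 * (a k + 2 * r k))
        + a k - r k) ≤ α * -(a k * log (r k)) := by
      rcases hα.eq_or_lt with h | h
      · simp [← h]
      apply mul_le_mul_of_nonneg_left _ hα
      apply pinsker_pt _ _ _ hak hrk
      intro h0
      rw [hr] at h0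
      have : α * a k = 0 := by nlinarith [mul_nonneg hα hak, mul_nonneg hβ hbk]
      simpa [h.ne'] using this
    have t2 : β * (negMulLog (b k) + (α * M * |b k - r k| - (α * M) ^ 2 / 6 * (b k + 2 * r k))
        + b k - r k) ≤ β * -(b k * log (r k)) := by
      rcases hβ.eq_or_lt with h | h
      · simp [← h]
      apply mul_le_mul_of_nonneg_left _ hβ
      apply pinsker_pt _ _ _ hbk hrk
      intro h0
      rw [hr] at h0
      have : β * b k = 0 := by nlinarith [mul_nonneg hα hak, mul_nonneg hβ hbk]
      simpa [h.ne'] using this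
    have e1 : |a k - r k| = β * |a k - b k| := by
      rw [show a k - r k = β * (a k - b k) by
        rw [hr]; linear_combination (-(a k)) * hαβ, abs_mul, abs_of_nonneg hβ]
    have e2 : |b k - r k| = α * |a k - b k| := by
      rw [show b k - r k = -(α * (a k - b k)) by
        rw [hr]; linear_combination (-(b k)) * hαβ, abs_neg, abs_mul, abs_of_nonneg hα]
    rw [e1] at t1
    rw [e2] at t2
    have e3 : negMulLog (r k) = α * -(a k * log (r k)) + β * -(b k * log (r k)) := by
      unfold negMulLog
      linear_combination (-(log (r k))) * hr k
    have e4 : α * (a k - r k) + β * (b k - r k) = 0 := by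
      linear_combination (-(r k)) * hαβ - hr k
    have e5 : α * β * M * |a k - b k| = (α + β) * (α * β * M * |a k - b k|) := by
      rw [hαβ, one_mul]
    rw [e3, e5]
    linarith
  have hrs : HasSum r 1 := by
    have := (ha.2.mul_left α).add (hb.2.mul_left β)
    rw [mul_one, mul_one, hαβ] at this
    exact this.congr_fun hr
  have S := ((ea.hasSum.mul_left α).add (eb.hasSum.mul_left β)).add
    ((hab.hasSum.mul_left (α * β * M)).sub
      ((((ha.2.add (hrs.mul_left 2)).mul_left β).add
        ((hb.2.add (hrs.mul_left 2)).mul_left α)).mul_left (α * β * M ^ 2 / 6)))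
  have := hasSum_le pt S er.hasSum
  have h6 : α * β * M * M ≤ α * β * M * ∑' k, |a k - b k| :=
    mul_le_mul_of_nonneg_left hM' (by positivity)
  have e7 : α * β * M ^ 2 / 6 * (β * (1 + 2 * 1) + α * (1 + 2 * 1)) = α * β * M ^ 2 / 2 := by
    linear_combination (α * β * M ^ 2 / 2) * hαβ
  unfold En
  linarith

/-- reindexing -/
def eqv : ℤ × ℤ ≃ ℤ × ℤ where
  toFun x := (x.2, x.1 - x.2)
  invFun x := (x.1 + x.2, x.1)
  left_inv x := by simp
  right_inv x := by simp

theorem pair_summable {p q : ℤ → ℝ} (hp : IsPMF p) (hq : IsPMF q) :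
    Summable fun x : ℤ × ℤ => p x.1 * q x.2 :=
  hp.2.summable.mul_of_nonneg hq.2.summable hp.1 hq.1

theorem conv_summable {p q : ℤ → ℝ} (hp : IsPMF p) (hq : IsPMF q) (k : ℤ) :
    Summable fun j => p j * q (k - j) :=
  ((eqv.summable_iff).2 (pair_summable hp hq)).prod_factor k

theorem conv_comm' (p q : ℤ → ℝ) : conv p q = conv q p := by
  funext k
  unfold conv
  rw [← (Equiv.subLeft k).tsum_eq]
  apply tsum_congr
  intro j
  simp [mul_comm]

theorem conv_test {p q : ℤ → ℝ} (hp : IsPMF p) (hq : IsPMF q) (s : ℤ → ℝ) (hs : ∀ k, |s k| ≤ 1) :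
    Summable (fun x : ℤ × ℤ => p x.1 * q x.2 * s (x.1 + x.2)) ∧
    HasSum (fun k => conv p q k * s k) (∑' x : ℤ × ℤ, p x.1 * q x.2 * s (x.1 + x.2)) := by
  have h1 : Summable (fun x : ℤ × ℤ => p x.1 * q x.2 * s (x.1 + x.2)) := by
    apply Summable.of_norm_bounded (pair_summable hp hq)
    intro x
    rw [norm_mul, Real.norm_eq_abs, Real.norm_eq_abs,
      abs_of_nonneg (mul_nonneg (hp.1 _) (hq.1 _))]
    exact mul_le_of_le_one_right (mul_nonneg (hp.1 _) (hq.1 _)) (hs _)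
  refine ⟨h1, ?_⟩
  have h2 := (eqv.hasSum_iff).2 h1.hasSum
  apply h2.prod_fiberwise
  intro k
  have := (conv_summable hp hq k).hasSum.mul_right (s k)
  simpa [eqv, conv] using this

theorem conv_pmf {p q : ℤ → ℝ} (hp : IsPMF p) (hq : IsPMF q) : IsPMF (conv p q) := by
  refine ⟨fun k => tsum_nonneg fun j => mul_nonneg (hp.1 _) (hq.1 _), ?_⟩
  have := (conv_test hp hq (fun _ => 1) (by simp)).2
  simp only [mul_one] at this
  rwa [(hp.2.mul hq.2 (pair_summable hp hq)).tsum_eq, one_mul] at this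

open Real in
theorem conv_fe {p q : ℤ → ℝ} (hp : IsPMF p) (hq : IsPMF q) (ep : FE p) (eq : FE q) :
    FE (conv p q) := by
  have h1 : Summable fun x : ℤ × ℤ => negMulLog (p x.1 * q x.2) := by
    have a1 : Summable fun x : ℤ × ℤ => negMulLog (p x.1) * q x.2 :=
      ep.mul_of_nonneg hq.2.summable hp.nml hq.1
    have a2 : Summable fun x : ℤ × ℤ => p x.1 * negMulLog (q x.2) :=
      hp.2.summable.mul_of_nonneg eq hp.1 hq.nml
    apply (a1.add a2).congr
    intro x
    rw [negMulLog_mul]; ring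
  have h2 : Summable fun x : ℤ × ℤ => negMulLog (p x.2 * q (x.1 - x.2)) := (eqv.summable_iff).2 h1
  have h3 : Summable fun k => ∑' j, negMulLog (p j * q (k - j)) := h2.prod
  apply Summable.of_nonneg_of_le (conv_pmf hp hq).nml _ h3
  intro k
  have hk := (conv_summable hp hq k).hasSum
  have hk' := (hk.mul_right (-log (conv p q k)))
  have e : negMulLog (conv p q k) = (∑' j, p j * q (k - j)) * (-log (conv p q k)) := by
    rw [negMulLog]; unfold conv; ring
  rw [e]
  refine hasSum_le ?_ hk' (h2.prod_factor k).hasSum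
  intro j
  have hn : 0 ≤ p j * q (k - j) := mul_nonneg (hp.1 _) (hq.1 _)
  rcases hn.eq_or_lt with h | h
  · simp [← h]
  have hle : p j * q (k - j) ≤ conv p q k :=
    hk.summable.le_tsum j (fun i _ => mul_nonneg (hp.1 _) (hq.1 _))
  have := Real.log_le_log h hle
  show _ ≤ negMulLog (p j * q (k - j))
  rw [negMulLog]
  nlinarith

open Real in
theorem conv_en {p q : ℤ → ℝ} (hp : IsPMF p) (hq : IsPMF q) (ep : FE p) (eq : FE q) :
    En q ≤ En (conv p q) := by
  have a2 : Summable fun x : ℤ × ℤ => p x.1 * negMulLog (q x.2) :=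
    hp.2.summable.mul_of_nonneg eq hp.1 hq.nml
  have h1 := hp.2.mul eq.hasSum a2
  rw [one_mul] at h1
  have h2 : HasSum (fun x : ℤ × ℤ => p x.2 * negMulLog (q (x.1 - x.2))) (En q) :=
    (eqv.hasSum_iff).2 h1
  have h3 := h2.prod_fiberwise (fun k => (h2.summable.prod_factor k).hasSum)
  refine hasSum_le ?_ h3 (conv_fe hp hq ep eq).hasSum
  intro k
  set r := conv p q k with hr
  have hrn : 0 ≤ r := (conv_pmf hp hq).1 k
  have hk : HasSum (fun j => p j * q (k - j)) r := (conv_summable hp hq k).hasSum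
  have S : HasSum (fun j => p j * q (k - j) * (-log r) - p j * q (k - j) + p j * r)
      (r * (-log r) - r + 1 * r) := ((hk.mul_right _).sub hk).add (hp.2.mul_right r)
  have e : negMulLog r = r * (-log r) - r + 1 * r := by rw [negMulLog]; ring
  rw [e]
  refine hasSum_le ?_ (h2.summable.prod_factor k).hasSum S
  intro j
  show p j * negMulLog (q (k - j)) ≤ _
  rcases (hp.1 j).eq_or_lt with h | h
  · simp [← h]
  have hle : p j * q (k - j) ≤ r :=
    hk.summable.le_tsum j (fun i _ => mul_nonneg (hp.1 _) (hq.1 _)) |>.trans_eq hk.tsum_eq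
  have := pinsker_pt (q (k - j)) r 0 (hq.1 _) hrn (by
    intro h0
    rw [h0] at hle
    have : p j * q (k - j) = 0 := le_antisymm hle (mul_nonneg (hp.1 _) (hq.1 _))
    simpa [h.ne'] using this)
  have := mul_le_mul_of_nonneg_left this h.le
  linarith

theorem conv_lin {p a b : ℤ → ℝ} (hp : IsPMF p) (ha : IsPMF a) (hb : IsPMF b) (r : ℤ → ℝ)
    (α β : ℝ) (hr : ∀ k, r k = α * a k + β * b k) (k : ℤ) :
    conv p r k = α * conv p a k + β * conv p b k := by
  have := ((conv_summable hp ha k).hasSum.mul_left α).add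
    ((conv_summable hp hb k).hasSum.mul_left β)
  unfold conv
  rw [← this.tsum_eq]
  apply tsum_congr
  intro j
  rw [hr]; ring

/-- combined entropy increase -/
theorem conv_mix {p a b : ℤ → ℝ} (hp : IsPMF p) (ep : FE p) (ha : IsPMF a) (hb : IsPMF b)
    (ea : FE a) (eb : FE b) (α β M : ℝ) (hα : 0 ≤ α) (hβ : 0 ≤ β) (hαβ : α + β = 1)
    (hr : ∀ k, p k = α * a k + β * b k) (hM : 0 ≤ M)
    (hM' : M ≤ ∑' k, |conv p a k - conv p b k|) :
    α * En (conv p a) + β * En (conv p b) + α * β * M ^ 2 / 2 ≤ En (conv p p) :=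
  mix _ _ (conv_pmf hp ha) (conv_pmf hp hb) (conv_fe hp ha ep ea) (conv_fe hp hb ep eb) α β M
    hα hβ hαβ _ (conv_lin hp ha hb p α β hr) (conv_fe hp hp ep ep) hM hM'

open Real in
theorem cond_facts {p : ℤ → ℝ} (hp : IsPMF p) (ep : FE p) (A : Set ℤ) (α : ℝ)
    (hα : 0 < α) (hA : HasSum (A.indicator p) α) :
    IsPMF (fun k => α⁻¹ * A.indicator p k) ∧ FE (fun k => α⁻¹ * A.indicator p k) ∧
    α * En (fun k => α⁻¹ * A.indicator p k) =
      (∑' k, A.indicator (fun k => negMulLog (p k)) k) - negMulLog α := by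
  have h1 : Summable (A.indicator fun k => negMulLog (p k)) := ep.indicator A
  have S := (hA.mul_right (negMulLog α⁻¹)).add (h1.hasSum.mul_left α⁻¹)
  have S' : HasSum (fun k => negMulLog (α⁻¹ * A.indicator p k))
      (α * negMulLog α⁻¹ + α⁻¹ * ∑' k, A.indicator (fun k => negMulLog (p k)) k) := by
    refine S.congr_fun ?_
    intro k
    rw [negMulLog_mul]
    by_cases hk : k ∈ A <;> simp [hk]
  refine ⟨⟨fun k => mul_nonneg (by positivity) (Set.indicator_nonneg (fun _ _ => hp.1 _) _), ?_⟩,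
    S'.summable, ?_⟩
  · have := hA.mul_left α⁻¹
    rwa [inv_mul_cancel₀ hα.ne'] at this
  · unfold En
    rw [S'.tsum_eq, negMulLog, negMulLog, Real.log_inv]
    field_simp
    ring

theorem cond_sum {p : ℤ → ℝ} (A : Set ℤ) (α β : ℝ) (hα : 0 < α) (hβ : 0 < β) (k : ℤ) :
    p k = α * (α⁻¹ * A.indicator p k) + β * (β⁻¹ * Aᶜ.indicator p k) := by
  rw [mul_inv_cancel_left₀ hα.ne', mul_inv_cancel_left₀ hβ.ne']
  by_cases hk : k ∈ A <;> simp [hk]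

theorem compl_mass {p : ℤ → ℝ} (hp : IsPMF p) (A : Set ℤ) (α : ℝ)
    (hA : HasSum (A.indicator p) α) : HasSum (Aᶜ.indicator p) (1 - α) := by
  refine (hp.2.sub hA).congr_fun ?_
  intro k
  by_cases hk : k ∈ A <;> simp [hk]

theorem exists_max {p : ℤ → ℝ} (hp : IsPMF p) : ∃ k0, 0 < p k0 ∧ ∀ k, p k ≤ p k0 := by
  have hex : ∃ k1, 0 < p k1 := by
    by_contra hcon
    push Not at hcon
    have : p = fun _ => 0 := funext fun k => le_antisymm (hcon k) (hp.1 k)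
    have h1 := hp.2
    rw [this] at h1
    exact one_ne_zero (h1.unique hasSum_zero)
  obtain ⟨k1, h1⟩ := hex
  have ht := hp.2.summable.tendsto_cofinite_zero
  have hev : ∀ᶠ k in Filter.cocompact ℤ, p k ≤ p k1 := by
    rw [Filter.cocompact_eq_cofinite]
    exact (ht.eventually (gt_mem_nhds h1)).mono fun _ h => h.le
  obtain ⟨k0, h0⟩ := Continuous.exists_forall_ge' (continuous_of_discreteTopology (f := p)) k1 hev
  exact ⟨k0, h1.trans_le (h0 k1), h0⟩

theorem exists_split {p : ℤ → ℝ} (hp : IsPMF p) (x : ℝ) (hx : x < 1) (hpx : ∀ k, p k ≤ x) :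
    ∃ i : ℤ, ∃ α, HasSum ((Set.Iic i).indicator p) α ∧ (1 - x) / 2 ≤ α ∧ α ≤ (1 + x) / 2 := by
  set S : ℤ → ℝ := fun i => ∑' k, (Set.Iic i).indicator p k with hS
  have hs : ∀ i, HasSum ((Set.Iic i).indicator p) (S i) := fun i =>
    (hp.2.summable.indicator _).hasSum
  have hstep : ∀ i, S i = S (i - 1) + p i := by
    intro i
    refine (hs i).unique (((hs (i - 1)).add (hasSum_ite_eq i (p i))).congr_fun ?_)
    intro k
    rcases lt_trichotomy k i with h | h | h
    · have h1 : k ≤ i - 1 := by omega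
      simp [h.le, h1, h.ne]
    · subst h; simp
    · have h1 : ¬ k ≤ i := by omega
      have h2 : ¬ k ≤ i - 1 := by omega
      simp [h1, h2, h.ne']
  have hmono : Monotone S := by
    intro i j hij
    refine hasSum_le ?_ (hs i) (hs j)
    intro k
    exact Set.indicator_le_indicator_of_subset (Set.Iic_subset_Iic.2 hij) hp.1 k
  have hFin : ∀ ε > 0, ∃ F : Finset ℤ, 1 - ε < ∑ k ∈ F, p k := by
    intro ε hε
    have := (hp.2.eventually (lt_mem_nhds (show 1 - ε < 1 by linarith))).exists
    exact this
  have hx0 : 0 < (1 - x) / 2 := by linarith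
  have hxn : 0 ≤ x := (hp.1 0).trans (hpx 0)
  have hinh : ∃ i, (1 - x) / 2 ≤ S i := by
    obtain ⟨F, hF⟩ := hFin ((1 + x) / 2) (by linarith)
    obtain ⟨m, hm⟩ := F.bddAbove
    refine ⟨m, ?_⟩
    have h1 : ∑ k ∈ F, (Set.Iic m).indicator p k ≤ S m :=
      sum_le_hasSum F (fun k _ => Set.indicator_nonneg (fun _ _ => hp.1 _) _) (hs m)
    have h2 : ∑ k ∈ F, (Set.Iic m).indicator p k = ∑ k ∈ F, p k :=
      Finset.sum_congr rfl fun k hk => Set.indicator_of_mem (Set.mem_Iic.2 (hm hk)) _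
    linarith
  have hbdd : ∃ b : ℤ, ∀ z, (1 - x) / 2 ≤ S z → b ≤ z := by
    obtain ⟨F, hF⟩ := hFin ((1 - x) / 2) (by linarith)
    obtain ⟨m, hm⟩ := F.bddBelow
    refine ⟨m, fun z hz => ?_⟩
    by_contra hcon
    push Not at hcon
    have h1 := compl_mass hp _ _ (hs z)
    have h2 : ∑ k ∈ F, (Set.Iic z)ᶜ.indicator p k ≤ 1 - S z :=
      sum_le_hasSum F (fun k _ => Set.indicator_nonneg (fun _ _ => hp.1 _) _) h1
    have h3 : ∑ k ∈ F, (Set.Iic z)ᶜ.indicator p k = ∑ k ∈ F, p k :=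
      Finset.sum_congr rfl fun k hk => Set.indicator_of_mem (by
        have := hm hk
        simp only [Set.mem_compl_iff, Set.mem_Iic]
        omega) _
    linarith
  obtain ⟨i, hi, hmin⟩ := Int.exists_least_of_bdd hbdd hinh
  refine ⟨i, S i, hs i, hi, ?_⟩
  have h1 : S (i - 1) < (1 - x) / 2 := by
    by_contra hcon
    push Not at hcon
    have := hmin _ hcon
    omega
  have := hpx i
  rw [hstep]
  linarith

theorem norm_bound2 {p a b : ℤ → ℝ} (hp : IsPMF p) (ha : IsPMF a) (hb : IsPMF b) (i k0 : ℤ)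
    (sa : ∀ l, i < l → a l = 0) (sb : ∀ l, l ≤ i → b l = 0) :
    2 * p k0 ≤ ∑' k, |conv p a k - conv p b k| := by
  set s : ℤ → ℝ := fun k => if k ≤ i + k0 then 1 else -1 with hs
  have hs1 : ∀ k, |s k| ≤ 1 := by
    intro k
    simp only [hs]
    split_ifs <;> simp
  have hanti : ∀ k l, k ≤ l → s l ≤ s k := by
    intro k l hkl
    simp only [hs]
    split_ifs <;> first | omega | norm_num
  obtain ⟨a1, a2⟩ := conv_test hp ha s hs1
  obtain ⟨b1, b2⟩ := conv_test hp hb s hs1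
  have hsum : ∀ c : ℤ, Summable fun j => p j * s (j + c) := by
    intro c
    apply Summable.of_norm_bounded hp.2.summable
    intro j
    rw [norm_mul, Real.norm_eq_abs, Real.norm_eq_abs, abs_of_nonneg (hp.1 _)]
    exact mul_le_of_le_one_right (hp.1 _) (hs1 _)
  have hprod : ∀ (c : ℤ) (q : ℤ → ℝ), IsPMF q →
      HasSum (fun y : ℤ × ℤ => (p y.1 * s (y.1 + c)) * q y.2) ((∑' j, p j * s (j + c)) * 1) := by
    intro c q hq
    refine (hsum c).hasSum.mul hq.2 ?_
    apply Summable.of_norm_bounded (pair_summable hp hq)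
    intro y
    rw [norm_mul, norm_mul, Real.norm_eq_abs, Real.norm_eq_abs, Real.norm_eq_abs,
      abs_of_nonneg (hp.1 _), abs_of_nonneg (hq.1 _)]
    exact mul_le_mul_of_nonneg_right (mul_le_of_le_one_right (hp.1 _) (hs1 _)) (hq.1 _)
  have ia := hasSum_le (fun y => ?_) (hprod i a ha) a1.hasSum
  swap
  · by_cases h : i < y.2
    · simp [sa _ h]
    · have := hanti (y.1 + y.2) (y.1 + i) (by omega)
      have h2 := mul_le_mul_of_nonneg_left this (mul_nonneg (hp.1 y.1) (ha.1 y.2))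
      linarith
  have ib := hasSum_le (fun y => ?_) b1.hasSum (hprod (i + 1) b hb)
  swap
  · by_cases h : y.2 ≤ i
    · simp [sb _ h]
    · have := hanti (y.1 + (i + 1)) (y.1 + y.2) (by omega)
      have h2 := mul_le_mul_of_nonneg_left this (mul_nonneg (hp.1 y.1) (hb.1 y.2))
      linarith
  have hd : HasSum (fun j => p j * s (j + i) - p j * s (j + (i + 1))) (2 * p k0) := by
    refine (hasSum_ite_eq k0 (2 * p k0)).congr_fun ?_
    intro j
    simp only [hs]
    split_ifs <;> first | omega | (subst_vars; ring)
  have hd2 := hd.unique ((hsum i).hasSum.sub (hsum (i + 1)).hasSum)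
  have hab : Summable fun k => |conv p a k - conv p b k| :=
    ((conv_pmf hp ha).2.summable.sub (conv_pmf hp hb).2.summable).abs
  have := hasSum_le (fun k => ?_) (a2.sub b2) hab.hasSum
  · linarith
  · rw [← sub_mul]
    refine (le_abs_self _).trans ?_
    rw [abs_mul]
    exact mul_le_of_le_one_right (abs_nonneg _) (hs1 k)

theorem norm_bound1 {p a b : ℤ → ℝ} (hp : IsPMF p) (ha : IsPMF a) (hb : IsPMF b) (i : ℤ)
    (sa : ∀ l, i < l → a l = 0) (sb : ∀ l, l ≤ i → b l = 0) (α β : ℝ) (hα : 0 ≤ α) (hβ : 0 ≤ β)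
    (hr : ∀ k, p k = α * a k + β * b k) :
    α + β - |β - α| ≤ ∑' k, |conv p a k - conv p b k| := by
  have hab : Summable fun k => |conv p a k - conv p b k| :=
    ((conv_pmf hp ha).2.summable.sub (conv_pmf hp hb).2.summable).abs
  have S := (((conv_pmf ha ha).2.mul_left α).add ((conv_pmf hb hb).2.mul_left β)).sub
    ((conv_pmf ha hb).2.mul_left |β - α|)
  simp only [mul_one] at S
  refine hasSum_le ?_ S hab.hasSum
  intro k
  have e1 : conv p a k = α * conv a a k + β * conv a b k := by
    rw [conv_comm' p a]; exact conv_lin ha ha hb p α β hr k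
  have e2 : conv p b k = α * conv a b k + β * conv b b k := by
    rw [conv_comm' p b, conv_comm' a b]; exact conv_lin hb ha hb p α β hr k
  have n1 := (conv_pmf ha ha).1 k
  have n2 := (conv_pmf hb hb).1 k
  have n3 := (conv_pmf ha hb).1 k
  have hz : conv a a k = 0 ∨ conv b b k = 0 := by
    by_cases h : k ≤ 2 * i
    · right
      have : (fun j => b j * b (k - j)) = fun _ => 0 := by
        funext j
        by_cases hj : j ≤ i
        · simp [sb _ hj]
        · simp [sb (k - j) (by omega)]
      simp [conv, this]
    · left
      have : (fun j => a j * a (k - j)) = fun _ => 0 := by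
        funext j
        by_cases hj : i < j
        · simp [sa _ hj]
        · simp [sa (k - j) (by omega)]
      simp [conv, this]
  have h1 : |(β - α) * conv a b k| = |β - α| * conv a b k := by
    rw [abs_mul, abs_of_nonneg n3]
  have h2 : conv p a k - conv p b k
      = α * conv a a k - β * conv b b k + (β - α) * conv a b k := by
    rw [e1, e2]; ring
  rw [h2]
  have m1 := mul_nonneg hα n1
  have m2 := mul_nonneg hβ n2
  have h3 := neg_abs_le ((β - α) * conv a b k)
  have h4 := le_abs_self ((β - α) * conv a b k)
  rcases hz with hz | hz
  · rw [hz] at *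
    refine le_trans ?_ (neg_le_abs _)
    linarith
  · rw [hz] at *
    refine le_trans ?_ (le_abs_self _)
    linarith

open Real in
theorem case_one {p : ℤ → ℝ} (hp : IsPMF p) (ep : FE p) (k0 : ℤ) (h0 : 0 < p k0)
    (h1 : p k0 < 1) :
    p k0 * En p + En p - (negMulLog (p k0) + negMulLog (1 - p k0)) ≤ En (conv p p) := by
  set x := p k0 with hx
  have hA : HasSum (({k0} : Set ℤ).indicator p) x := by
    refine (hasSum_ite_eq k0 x).congr_fun ?_
    intro k
    by_cases h : k = k0
    · subst h; simp [hx]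
    · simp [h]
  have hB := compl_mass hp _ _ hA
  obtain ⟨pa, fa, ea⟩ := cond_facts hp ep _ _ h0 hA
  obtain ⟨pb, fb, eb⟩ := cond_facts hp ep _ _ (show 0 < 1 - x by linarith) hB
  have hm := conv_mix hp ep pa pb fa fb x (1 - x) 0 h0.le (by linarith) (by ring)
    (cond_sum _ x (1 - x) h0 (by linarith)) le_rfl (tsum_nonneg fun _ => abs_nonneg _)
  have q1 := conv_en pa hp fa ep
  rw [conv_comm'] at q1
  have q2 := conv_en hp pb ep fb
  have hs : HasSum (fun k => negMulLog (p k)) _ :=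
    (((show Summable _ from ep).indicator ({k0} : Set ℤ)).hasSum.add
      ((show Summable _ from ep).indicator ({k0} : Set ℤ)ᶜ).hasSum).congr_fun (by
        intro k
        by_cases h : k = k0 <;> simp [h])
  have hs2 := hs.tsum_eq
  have ht : ∑' k, ({k0} : Set ℤ).indicator (fun k => negMulLog (p k)) k = negMulLog x := by
    refine HasSum.tsum_eq ((hasSum_ite_eq k0 (negMulLog x)).congr_fun ?_)
    intro k
    by_cases h : k = k0
    · subst h; simp [hx]
    · simp [h]
  have g1 := mul_le_mul_of_nonneg_left q1 h0.le
  have g2 := mul_le_mul_of_nonneg_left q2 (show 0 ≤ 1 - x by linarith)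
  rw [eb] at g2
  change En p = _ at hs2
  rw [ht] at hs2
  linarith

theorem case_two {p : ℤ → ℝ} (hp : IsPMF p) (ep : FE p) (k0 : ℤ) (h0 : 0 < p k0)
    (h1 : p k0 < 1) (hmax : ∀ k, p k ≤ p k0) :
    En p + (1 - p k0) ^ 2 * (max (1 - p k0) (max (4 * p k0 - 2) 0)) ^ 2 / 8 ≤ En (conv p p) := by
  obtain ⟨i, α, hA, hα1, hα2⟩ := exists_split hp (p k0) h1 hmax
  have hα : 0 < α := by linarith
  have hβ : 0 < 1 - α := by linarith
  have hB := compl_mass hp _ _ hA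
  obtain ⟨pa, fa, -⟩ := cond_facts hp ep _ _ hα hA
  obtain ⟨pb, fb, -⟩ := cond_facts hp ep _ _ hβ hB
  have hr := cond_sum (p := p) (Set.Iic i) α (1 - α) hα hβ
  have sa : ∀ l, i < l → α⁻¹ * (Set.Iic i).indicator p l = 0 := by
    intro l hl
    simp [hl]
  have sb : ∀ l, l ≤ i → (1 - α)⁻¹ * (Set.Iic i)ᶜ.indicator p l = 0 := by
    intro l hl
    rw [Set.indicator_of_notMem (by simpa using hl), mul_zero]
  have n1 := norm_bound1 hp pa pb i sa sb α (1 - α) hα.le hβ.le hr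
  have n2 := norm_bound2 hp pa pb i k0 sa sb
  have habs : |1 - α - α| ≤ p k0 := abs_le.2 ⟨by linarith, by linarith⟩
  set M := max (1 - p k0) (max (4 * p k0 - 2) 0) with hM
  have hM0 : 0 ≤ M := le_max_of_le_right (le_max_right _ _)
  have hm := conv_mix hp ep pa pb fa fb α (1 - α) M hα.le hβ.le (by ring) hr hM0
    (max_le (by linarith) (max_le (by linarith) (by linarith)))
  have q1 := conv_en pa hp fa ep
  rw [conv_comm'] at q1
  have q2 := conv_en pb hp fb ep
  rw [conv_comm'] at q2
  have g1 := mul_le_mul_of_nonneg_left q1 hα.le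
  have g2 := mul_le_mul_of_nonneg_left q2 hβ.le
  have g3 : (1 - p k0) ^ 2 / 4 ≤ α * (1 - α) := by
    nlinarith [mul_nonneg (sub_nonneg.2 hα1) (sub_nonneg.2 hα2)]
  have g4 := mul_le_mul_of_nonneg_right g3 (sq_nonneg M)
  linarith

open Real in
theorem delta_case {p : ℤ → ℝ} (hp : IsPMF p) (k0 : ℤ) (h : p k0 = 1) : En p = 0 := by
  have : ∀ k, negMulLog (p k) = 0 := by
    intro k
    by_cases hk : k = k0
    · subst hk; simp [h]
    · have h2 := sum_le_hasSum {k, k0} (fun j _ => hp.1 j) hp.2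
      rw [Finset.sum_pair hk] at h2
      have : p k = 0 := le_antisymm (by linarith) (hp.1 k)
      simp [this]
  simp [En, this]

/-- if `p` is a probability distribution on `ℤ` with finite entropy
`H(p) = c`, then `H(p⋆p) − c ≥ g(c)`. -/
theorem stmt0 (p : ℤ → ℝ) (c : ℝ) (hp : IsPMF p)
    (hc : HasSum (fun k => -(p k * Real.logb 2 (p k))) c) :
    entH (conv p p) - c ≥ gIID c := by
  have hl : 0 < Real.log 2 := Real.log_pos (by norm_num)
  have hpt : ∀ t : ℝ, -(t * Real.logb 2 t) = Real.negMulLog t / Real.log 2 := by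
    intro t
    rw [Real.logb, Real.negMulLog]; ring
  have hE : HasSum (fun k => Real.negMulLog (p k)) (c * Real.log 2) := by
    refine (hc.mul_right (Real.log 2)).congr_fun ?_
    intro k
    rw [hpt, div_mul_cancel₀ _ hl.ne']
  have ep : FE p := hE.summable
  have hEn : En p = c * Real.log 2 := hE.tsum_eq
  have hent : entH (conv p p) = En (conv p p) / Real.log 2 := by
    unfold entH En
    simp_rw [hpt]
    rw [tsum_div_const]
  obtain ⟨k0, h0, hmax⟩ := exists_max hp
  have hle1 := hp.le_one k0
  have hbdd : BddBelow ((fun x : ℝ => max (c * x - H2 x)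
    ((1 - x) ^ 2 * (max (1 - x) (max (4 * x - 2) 0)) ^ 2 / (8 * Real.log 2)))
    '' Set.Icc (0 : ℝ) 1) := by
    refine ⟨0, ?_⟩
    rintro _ ⟨x, -, rfl⟩
    exact le_max_of_le_right (by positivity)
  have hg : gIID c ≤ _ := csInf_le hbdd ⟨p k0, ⟨h0.le, hle1⟩, rfl⟩
  refine ge_iff_le.2 (hg.trans ?_)
  rw [hent]
  rcases hle1.eq_or_lt with h1 | h1
  · have hz := delta_case hp k0 h1
    have q := conv_en hp hp ep ep
    have hcz : c = 0 := by
      rw [hz] at hEn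
      rcases mul_eq_zero.1 hEn.symm with h | h
      · exact h
      · exact absurd h hl.ne'
    rw [hz] at q
    have : 0 ≤ En (conv p p) / Real.log 2 := by positivity
    simp [h1, hcz, H2, this]
  · have c1 := case_one hp ep k0 h0 h1
    have c2 := case_two hp ep k0 h0 h1 hmax
    rw [hEn] at c1 c2
    apply max_le
    · have e : H2 (p k0) = (Real.negMulLog (p k0) + Real.negMulLog (1 - p k0)) / Real.log 2 := by
        have := hpt (1 - p k0)
        rw [H2, hpt, add_div, ← this]; ring
      rw [e, le_sub_iff_add_le, le_div_iff₀ hl]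
      have e2 := div_mul_cancel₀ (Real.negMulLog (p k0) + Real.negMulLog (1 - p k0)) hl.ne'
      linarith
    · rw [le_sub_iff_add_le, le_div_iff₀ hl, add_mul]
      have e2 : (1 - p k0) ^ 2 * (max (1 - p k0) (max (4 * p k0 - 2) 0)) ^ 2 / (8 * Real.log 2)
          * Real.log 2 = (1 - p k0) ^ 2 * (max (1 - p k0) (max (4 * p k0 - 2) 0)) ^ 2 / 8 := by
        field_simp
      linarith
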